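/- For any constant s ≥ 1/2, the Dirichlet-to-Neumann mapping S is a bounded linear operator from H^s(Γ_R) to H^{s−1}(Γ_R): there exists a constant c > 0 independent of φ such that ‖Sφ‖_{H^{s−1}(Γ_R)} ≤ c ‖φ‖_{H^s(Γ_R)} for all φ ∈ H^s(Γ_R). -/

import Mathlib

/-!
Formalization of results from "A priori error estimates of the DtN-FEM:
fluid-solid interaction problems" by T. Yin and L. Xu.

Modeling conventions:
* `V2 = EuclideanSpace ℝ (Fin 2)` is the plane.
* Sobolev norms `H^t(E)` (integer and fractional) are modeled concretely via
  iterated derivatives and Gagliardo-type seminorms (`sobNormSq`).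
* Functions on the circle `Γ_R` are handled through their Fourier coefficients
  (`circCoeff`), and the DtN map through its Fourier multiplier `dtnCoeff`
  built from explicitly defined Hankel functions of the first kind.
* The boundary measure on `Γ = ∂Ω` is a parameter `μΓ` supported on `Γ`,
  and `nv` denotes the outward unit normal field.
-/

noncomputable section
open MeasureTheory Complex Real Filter
abbrev V2 := EuclideanSpace ℝ (Fin 2)
namespace FSI

/-! ### Bessel and Hankel functions, and the DtN Fourier multiplier -/

/-- Bessel function of the first kind of integer order (power series). -/
def besselJ (n : ℕ) (x : ℝ) : ℝ :=
  ∑' m : ℕ, ((-1 : ℝ) ^ m / (m.factorial * (m + n).factorial)) * (x / 2) ^ (2 * m + n)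
def harmonicNum (m : ℕ) : ℝ := ∑ i ∈ Finset.range m, (1 : ℝ) / (i + 1)
/-- Bessel function of the second kind of integer order. -/
def besselY (n : ℕ) (x : ℝ) : ℝ :=
  (2 / π) * (Real.log (x / 2) + Real.eulerMascheroniConstant) * besselJ n x
    - (1 / π) * ∑ m ∈ Finset.range n,
        (((n - 1 - m).factorial : ℝ) / m.factorial) * (x / 2) ^ (2 * (m : ℤ) - (n : ℤ))
    - (1 / π) * ∑' m : ℕ,
        ((-1 : ℝ) ^ m * (harmonicNum m + harmonicNum (m + n)) /
          (m.factorial * (m + n).factorial)) * (x / 2) ^ (2 * m + n)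
/-- Hankel function of the first kind `H_n^{(1)} = J_n + i Y_n`, integer order. -/
def hankelH1ofNat (n : ℕ) (x : ℝ) : ℂ := (besselJ n x : ℂ) + Complex.I * (besselY n x : ℂ)
def hankelH1 (n : ℤ) (x : ℝ) : ℂ :=
  if 0 ≤ n then hankelH1ofNat n.natAbs x else (-1 : ℂ) ^ n.natAbs * hankelH1ofNat n.natAbs x
def hankelH1d (n : ℤ) (x : ℝ) : ℂ := deriv (fun t : ℝ => hankelH1 n t) x
/-- Hankel function of the second kind `H_n^{(2)} = J_n - i Y_n`, integer order. -/
def hankelH2ofNat (n : ℕ) (x : ℝ) : ℂ := (besselJ n x : ℂ) - Complex.I * (besselY n x : ℂ)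
def hankelH2 (n : ℤ) (x : ℝ) : ℂ :=
  if 0 ≤ n then hankelH2ofNat n.natAbs x else (-1 : ℂ) ^ n.natAbs * hankelH2ofNat n.natAbs x
def hankelH2d (n : ℤ) (x : ℝ) : ℂ := deriv (fun t : ℝ => hankelH2 n t) x
/-- the Fourier multiplier `k H_n^{(1)'}(kR) / H_n^{(1)}(kR)` of the DtN map `S`. -/
def dtnCoeff (k R : ℝ) (n : ℤ) : ℂ := (k : ℂ) * hankelH1d n (k * R) / hankelH1 n (k * R)

/-! ### Sobolev spaces on the circle, via Fourier coefficients -/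

/-- `H^s(Γ_R)`-norm of a function on the circle given by its Fourier coefficients. -/
def hSeqNorm (s : ℝ) (a : ℤ → ℂ) : ℝ :=
  Real.sqrt (∑' n : ℤ, (1 + (n : ℝ) ^ 2) ^ s * ‖a n‖ ^ 2)
def MemHseq (s : ℝ) (a : ℤ → ℂ) : Prop :=
  Summable (fun n : ℤ => (1 + (n : ℝ) ^ 2) ^ s * ‖a n‖ ^ 2)

/-- A series `∑ c m (t/2)^(2m+n)` with `|c m| ≤ 2 / m!` is differentiable, and its value and
derivative at `x` grow at most geometrically in `n`. -/
theorem exists_hasDerivAt_tsum_half_pow (x : ℝ) (n : ℕ) (c : ℕ → ℝ)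
    (hc : ∀ m, |c m| ≤ 2 / m.factorial) :
    ∃ d : ℝ, HasDerivAt (fun t : ℝ => ∑' m : ℕ, c m * (t / 2) ^ (2 * m + n)) d x ∧
      |d| ≤ 2 * (|x| + 2) ^ n * Real.exp ((|x| + 2) ^ 2) ∧
      |∑' m : ℕ, c m * (x / 2) ^ (2 * m + n)|
        ≤ 2 * (|x| + 2) ^ n * Real.exp ((|x| + 2) ^ 2) := by
  set D : ℝ := |x| + 2 with hD
  have hx0 : 0 ≤ |x| := abs_nonneg x
  have hD0 : 0 ≤ D := by positivity
  let u : ℕ → ℝ := fun m => 2 * D ^ n * ((D ^ 2) ^ m / m.factorial)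
  have hu : HasSum u (2 * D ^ n * Real.exp (D ^ 2)) := by
    rw [Real.exp_eq_exp_ℝ]
    exact (NormedSpace.expSeries_div_hasSum_exp (D ^ 2)).mul_left _
  have key : ∀ m : ℕ, ∀ r : ℝ, |r| ≤ D ^ (2 * m + n) → |c m * r| ≤ u m := by
    intro m r hr
    rw [abs_mul]
    calc |c m| * |r| ≤ 2 / m.factorial * D ^ (2 * m + n) := by
          gcongr
          exact hc m
      _ = u m := by simp only [u, pow_add, pow_mul]; ring
  have hval : ∀ m : ℕ, |c m * (x / 2) ^ (2 * m + n)| ≤ u m := by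
    intro m
    refine key m _ ?_
    rw [abs_pow, abs_div, abs_two]
    gcongr
    linarith
  have hder : ∀ m : ℕ, ∀ y ∈ Metric.ball (0 : ℝ) D,
      ‖c m * (((2 * m + n : ℕ) : ℝ) * (y / 2) ^ (2 * m + n - 1) * (1 / 2))‖ ≤ u m := by
    intro m y hy
    refine key m _ ?_
    have hy' : |y| ≤ D := by
      rw [mem_ball_zero_iff, Real.norm_eq_abs] at hy
      exact hy.le
    generalize 2 * m + n = N
    rcases N with _ | N
    · simp
    · have h2 : ((N + 1 : ℕ) : ℝ) ≤ 2 ^ N := by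
        exact_mod_cast Nat.lt_two_pow_self
      have hy0 : |y| ^ N ≤ D ^ N := by gcongr
      rw [abs_mul, abs_mul, abs_pow, abs_div, abs_two, Nat.abs_cast, Nat.add_sub_cancel]
      calc ((N + 1 : ℕ) : ℝ) * (|y| / 2) ^ N * |1 / 2|
          ≤ 2 ^ N * (|y| / 2) ^ N * |1 / 2| := by gcongr
        _ = |y| ^ N * (1 / 2) := by
            rw [← mul_pow, mul_div_cancel₀ _ (two_ne_zero' ℝ), abs_of_pos (by norm_num : (0 : ℝ) < 1 / 2)]
        _ ≤ D ^ N * D := by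
            gcongr
            linarith
        _ = D ^ (N + 1) := (pow_succ _ _).symm
  have hxmem : x ∈ Metric.ball (0 : ℝ) D := by
    rw [mem_ball_zero_iff, Real.norm_eq_abs]
    linarith
  refine ⟨_, hasDerivAt_tsum_of_isPreconnected
    (g := fun m (t : ℝ) => c m * (t / 2) ^ (2 * m + n))
    (g' := fun m (t : ℝ) => c m * (((2 * m + n : ℕ) : ℝ) * (t / 2) ^ (2 * m + n - 1) * (1 / 2)))
    hu.summable Metric.isOpen_ball (convex_ball (0 : ℝ) D).isPreconnected
    (fun m y _ => ?_) hder hxmem (Summable.of_norm_bounded hu.summable hval) hxmem, ?_, ?_⟩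
  · exact (((hasDerivAt_id y).div_const 2).pow (2 * m + n)).const_mul (c m)
  · exact tsum_of_norm_bounded hu fun m => hder m x hxmem
  · rw [← Real.norm_eq_abs]
    exact tsum_of_norm_bounded hu hval

theorem harmonicNum_nonneg (m : ℕ) : 0 ≤ harmonicNum m :=
  Finset.sum_nonneg fun i _ => by positivity

theorem harmonicNum_le (m : ℕ) : harmonicNum m ≤ m := by
  calc harmonicNum m ≤ ∑ _i ∈ Finset.range m, (1 : ℝ) := by
        refine Finset.sum_le_sum fun i _ => ?_
        rw [div_le_one (by positivity)]
        linarith [(Nat.cast_nonneg i : (0 : ℝ) ≤ i)]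
    _ = m := by simp

theorem abs_besselJ_coeff_le (n m : ℕ) :
    |(-1 : ℝ) ^ m / (m.factorial * (m + n).factorial)| ≤ 2 / m.factorial := by
  have h : (1 : ℝ) ≤ (m + n).factorial := by
    exact_mod_cast Nat.one_le_iff_ne_zero.2 (m + n).factorial_ne_zero
  have hm : (0 : ℝ) < m.factorial := by positivity
  rw [abs_div, abs_pow, abs_neg, abs_one, one_pow, abs_of_pos (by positivity)]
  gcongr
  · norm_num
  · exact le_mul_of_one_le_right hm.le h

theorem abs_besselY_coeff_le (n m : ℕ) :
    |(-1 : ℝ) ^ m * (harmonicNum m + harmonicNum (m + n)) / (m.factorial * (m + n).factorial)|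
      ≤ 2 / m.factorial := by
  have h : ((m + n : ℕ) : ℝ) ≤ (m + n).factorial := by exact_mod_cast Nat.self_le_factorial _
  have hm : (0 : ℝ) < m.factorial := by positivity
  have hmn : (0 : ℝ) < (m + n).factorial := by positivity
  have h1 := harmonicNum_le m
  have h2 := harmonicNum_le (m + n)
  have h3 := harmonicNum_nonneg m
  have h4 := harmonicNum_nonneg (m + n)
  rw [abs_div, abs_mul, abs_pow, abs_neg, abs_one, one_pow, one_mul, abs_of_nonneg (by positivity),
    abs_of_pos (by positivity : (0 : ℝ) < m.factorial * (m + n).factorial),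
    div_le_div_iff₀ (by positivity) hm]
  push_cast at h h2
  have : harmonicNum m + harmonicNum (m + n) ≤ 2 * (m + n).factorial := by
    linarith [(Nat.cast_nonneg n : (0 : ℝ) ≤ n)]
  nlinarith

/-- The singular (finite) part of `-π Y_n`. -/
def besselYSing (n : ℕ) (x : ℝ) : ℝ :=
  ∑ m ∈ Finset.range n,
    (((n - 1 - m).factorial : ℝ) / m.factorial) * (x / 2) ^ (2 * (m : ℤ) - (n : ℤ))

theorem exists_hasDerivAt_besselYSing {x : ℝ} (hx : 0 < x) (n : ℕ) :
    ∃ d : ℝ, HasDerivAt (besselYSing n) d x ∧ |d| ≤ n / x * besselYSing n x := by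
  refine ⟨∑ m ∈ Finset.range n, (((n - 1 - m).factorial : ℝ) / m.factorial) *
    (((2 * (m : ℤ) - (n : ℤ) : ℤ) : ℝ) * (x / 2) ^ (2 * (m : ℤ) - (n : ℤ) - 1) * (1 / 2)), ?_, ?_⟩
  · refine HasDerivAt.fun_sum fun m _ => HasDerivAt.const_mul _ ?_
    exact (hasDerivAt_zpow _ (x / 2) (Or.inl (by positivity))).comp x
      ((hasDerivAt_id x).div_const 2)
  · refine (Finset.abs_sum_le_sum_abs _ _).trans ?_
    rw [besselYSing, Finset.mul_sum]
    refine Finset.sum_le_sum fun m hm => ?_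
    have hm' : (m : ℝ) < n := by exact_mod_cast Finset.mem_range.1 hm
    have hm0 : (0 : ℝ) ≤ m := by positivity
    have hz : |((2 * (m : ℤ) - (n : ℤ) : ℤ) : ℝ)| ≤ n := by
      push_cast
      rw [abs_le]
      constructor <;> linarith
    have hx2 : x / 2 ≠ 0 := by positivity
    rw [zpow_sub_one₀ hx2, abs_mul, abs_mul, abs_mul, abs_mul,
      abs_of_nonneg (by positivity : (0 : ℝ) ≤ ((n - 1 - m).factorial : ℝ) / m.factorial),
      abs_of_pos (by positivity : 0 < (x / 2) ^ (2 * (m : ℤ) - (n : ℤ))),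
      abs_of_pos (by positivity : 0 < (x / 2)⁻¹), abs_of_pos (by norm_num : (0 : ℝ) < 1 / 2)]
    calc ((n - 1 - m).factorial : ℝ) / m.factorial *
          (|((2 * (m : ℤ) - (n : ℤ) : ℤ) : ℝ)| *
            ((x / 2) ^ (2 * (m : ℤ) - (n : ℤ)) * (x / 2)⁻¹) * (1 / 2))
        ≤ ((n - 1 - m).factorial : ℝ) / m.factorial *
          (n * ((x / 2) ^ (2 * (m : ℤ) - (n : ℤ)) * (x / 2)⁻¹) * (1 / 2)) := by gcongr
      _ = n / x * (((n - 1 - m).factorial : ℝ) / m.factorial *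
          (x / 2) ^ (2 * (m : ℤ) - (n : ℤ))) := by
        field_simp

theorem le_besselYSing_succ {x : ℝ} (hx : 0 < x) (n : ℕ) :
    (n.factorial : ℝ) / (x / 2) ^ (n + 1) ≤ besselYSing (n + 1) x := by
  have h := Finset.single_le_sum (s := Finset.range (n + 1))
    (f := fun m => (((n + 1 - 1 - m).factorial : ℝ) / m.factorial) *
      (x / 2) ^ (2 * (m : ℤ) - ((n + 1 : ℕ) : ℤ)))
    (fun m _ => by positivity) (Finset.mem_range.2 n.succ_pos)
  refine le_trans (le_of_eq ?_) h
  simp only [Nat.add_sub_cancel, Nat.sub_zero, Nat.factorial_zero, Nat.cast_one,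
    Nat.cast_zero, mul_zero, zero_sub, zpow_neg, zpow_natCast, div_eq_mul_inv, inv_one, mul_one]

theorem besselYSing_nonneg {x : ℝ} (hx : 0 < x) (n : ℕ) : 0 ≤ besselYSing n x :=
  Finset.sum_nonneg fun m _ => by positivity

/-- Geometric growth is negligible against the singular part of `Y_n`. -/
theorem eventually_mul_pow_le_besselYSing {x : ℝ} (hx : 0 < x) {K D : ℝ} (hD : 0 ≤ D) :
    ∀ᶠ n : ℕ in atTop, K * D ^ n ≤ besselYSing n x := by
  have hlim : Tendsto (fun n : ℕ => |K| * (D * (x / 2)) * ((D * (x / 2)) ^ n / n.factorial)) atTop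
      (nhds (|K| * (D * (x / 2)) * 0)) :=
    (FloorSemiring.tendsto_pow_div_factorial_atTop (D * (x / 2))).const_mul _
  rw [mul_zero] at hlim
  refine eventually_atTop.2 ?_
  obtain ⟨N, hN⟩ := eventually_atTop.1 (hlim.eventually_le_const one_pos)
  refine ⟨N + 1, fun n hn => ?_⟩
  obtain ⟨n, rfl⟩ : ∃ j, n = j + 1 := ⟨n - 1, by omega⟩
  refine le_trans ?_ (le_besselYSing_succ hx n)
  have h := hN n (by omega)
  rw [← mul_div_assoc, div_le_one (by positivity)] at h
  rw [le_div_iff₀ (by positivity)]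
  calc K * D ^ (n + 1) * (x / 2) ^ (n + 1) ≤ |K| * D ^ (n + 1) * (x / 2) ^ (n + 1) := by
        gcongr
        exact le_abs_self K
    _ = |K| * (D * (x / 2)) * (D * (x / 2)) ^ n := by ring
    _ ≤ n.factorial := h

theorem exists_hasDerivAt_besselJ (x : ℝ) (n : ℕ) :
    ∃ d : ℝ, HasDerivAt (besselJ n) d x ∧
      |d| ≤ 2 * (|x| + 2) ^ n * Real.exp ((|x| + 2) ^ 2) ∧
      |besselJ n x| ≤ 2 * (|x| + 2) ^ n * Real.exp ((|x| + 2) ^ 2) :=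
  exists_hasDerivAt_tsum_half_pow x n _ (abs_besselJ_coeff_le n)

/-- `Y_n` equals `-1/π` times its singular part up to an error of geometric growth in `n`,
and likewise for the derivative. -/
theorem exists_besselY_bounds {x : ℝ} (hx : 0 < x) :
    ∃ K > 0, ∀ n : ℕ, ∃ d : ℝ, HasDerivAt (besselY n) d x ∧
      |d| ≤ n / x * besselYSing n x + K * (|x| + 2) ^ n ∧
      besselYSing n x / π - K * (|x| + 2) ^ n ≤ |besselY n x| := by
  set E := 2 * Real.exp ((|x| + 2) ^ 2) with hE
  have hE0 : 0 < E := by positivity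
  set L := (2 / π) * (Real.log (x / 2) + Real.eulerMascheroniConstant) with hL
  refine ⟨(2 / π) * (1 / x) * E + |L| * E + E, by positivity, fun n => ?_⟩
  have hπ : 1 / π ≤ 1 := by
    rw [div_le_one Real.pi_pos]
    linarith [Real.pi_gt_three]
  have hπ0 : 0 < 1 / π := by positivity
  obtain ⟨dJ, hJ, hdJ, hJx⟩ := exists_hasDerivAt_besselJ x n
  obtain ⟨dF, hF, hdF⟩ := exists_hasDerivAt_besselYSing hx n
  obtain ⟨dS, hS, hdS, hSx⟩ := exists_hasDerivAt_tsum_half_pow x n _ (abs_besselY_coeff_le n)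
  have hF0 := besselYSing_nonneg hx n
  set P := (|x| + 2) ^ n with hP
  have hP0 : 0 < P := by positivity
  have hPE : 2 * P * Real.exp ((|x| + 2) ^ 2) = E * P := by ring
  rw [hPE] at hdJ hJx hdS hSx
  have hlog : HasDerivAt (fun t : ℝ => (2 / π) * (Real.log (t / 2) + Real.eulerMascheroniConstant))
      ((2 / π) * (1 / x)) x := by
    have h : (1 : ℝ) / x = 1 / 2 / (x / 2) := by field_simp
    rw [h]
    exact ((((hasDerivAt_id x).div_const 2).log (by simpa using hx.ne')).add_const
      Real.eulerMascheroniConstant).const_mul (2 / π)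
  have hY : HasDerivAt (besselY n)
      ((2 / π) * (1 / x) * besselJ n x + L * dJ - (1 / π) * dF - (1 / π) * dS) x :=
    ((hlog.mul hJ).sub (hF.const_mul (1 / π))).sub (hS.const_mul (1 / π))
  refine ⟨_, hY, ?_, ?_⟩
  · have a1 : |(2 / π) * (1 / x) * besselJ n x| ≤ (2 / π) * (1 / x) * (E * P) := by
      rw [abs_mul, abs_of_pos (by positivity)]
      gcongr
    have a2 : |L * dJ| ≤ |L| * (E * P) := by
      rw [abs_mul]
      gcongr
    have a3 : |(1 / π) * dF| ≤ n / x * besselYSing n x := by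
      rw [abs_mul, abs_of_pos hπ0]
      exact (mul_le_of_le_one_left (abs_nonneg _) hπ).trans hdF
    have a4 : |(1 / π) * dS| ≤ E * P := by
      rw [abs_mul, abs_of_pos hπ0]
      exact (mul_le_of_le_one_left (abs_nonneg _) hπ).trans hdS
    have b1 := abs_sub ((2 / π) * (1 / x) * besselJ n x + L * dJ - (1 / π) * dF) ((1 / π) * dS)
    have b2 := abs_sub ((2 / π) * (1 / x) * besselJ n x + L * dJ) ((1 / π) * dF)
    have b3 := abs_add_le ((2 / π) * (1 / x) * besselJ n x) (L * dJ)
    linarith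
  · have hYx : besselY n x = L * besselJ n x - (1 / π) * besselYSing n x - (1 / π) *
        ∑' m : ℕ, ((-1 : ℝ) ^ m * (harmonicNum m + harmonicNum (m + n)) /
          (m.factorial * (m + n).factorial)) * (x / 2) ^ (2 * m + n) := rfl
    set T := ∑' m : ℕ, ((-1 : ℝ) ^ m * (harmonicNum m + harmonicNum (m + n)) /
          (m.factorial * (m + n).factorial)) * (x / 2) ^ (2 * m + n)
    have a2 : |L * besselJ n x| ≤ |L| * (E * P) := by
      rw [abs_mul]
      gcongr
    have a4 : |(1 / π) * T| ≤ E * P := by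
      rw [abs_mul, abs_of_pos hπ0]
      exact (mul_le_of_le_one_left (abs_nonneg _) hπ).trans hSx
    have a1 : 0 ≤ (2 / π) * (1 / x) * (E * P) := by positivity
    have c1 := neg_le_abs (besselY n x)
    have c2 := le_abs_self (L * besselJ n x)
    have c3 := neg_abs_le ((1 / π) * T)
    have c4 : besselYSing n x / π = (1 / π) * besselYSing n x := by ring
    rw [c4]
    linarith

theorem eventually_norm_deriv_hankel_le {x : ℝ} (hx : 0 < x) :
    ∃ C : ℝ, ∀ᶠ n : ℕ in atTop,
      ‖deriv (hankelH1ofNat n) x‖ / ‖hankelH1ofNat n x‖ ≤ C * (n + 1) := by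
  obtain ⟨K, hK, hY⟩ := exists_besselY_bounds hx
  set E := 2 * Real.exp ((|x| + 2) ^ 2) with hE
  have hE0 : 0 < E := by positivity
  have hD : 0 < |x| + 2 := by positivity
  have hπ := Real.pi_pos
  refine ⟨2 * π * (1 / x + 1), ?_⟩
  filter_upwards [eventually_mul_pow_le_besselYSing (K := 2 * π * K) hx hD.le,
    eventually_mul_pow_le_besselYSing (K := E + K) hx hD.le] with n h1 h2
  obtain ⟨dJ, hJ, hdJ, -⟩ := exists_hasDerivAt_besselJ x n
  obtain ⟨dY, hdY, hdYle, hYle⟩ := hY n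
  set P := (|x| + 2) ^ n with hP
  have hP0 : 0 < P := by positivity
  set F := besselYSing n x with hF
  have hF0 : 0 < F := lt_of_lt_of_le (by positivity) h1
  have hH : HasDerivAt (hankelH1ofNat n) ((dJ : ℂ) + Complex.I * (dY : ℂ)) x :=
    hJ.ofReal_comp.add (hdY.ofReal_comp.const_mul Complex.I)
  have hnum : ‖(dJ : ℂ) + Complex.I * (dY : ℂ)‖ ≤ (1 / x + 1) * (n + 1) * F := by
    have h3 := norm_add_le (dJ : ℂ) (Complex.I * (dY : ℂ))
    rw [norm_mul, Complex.norm_I, one_mul, Complex.norm_real, Complex.norm_real,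
      Real.norm_eq_abs, Real.norm_eq_abs] at h3
    have h4 : (1 / x + 1) * (n + 1) * F = n / x * F + F + (F / x + n * F) := by ring
    have h5 : 0 ≤ F / x + n * F := by positivity
    have h6 : 2 * P * Real.exp ((|x| + 2) ^ 2) = E * P := by ring
    linarith
  have hden : F / (2 * π) ≤ ‖hankelH1ofNat n x‖ := by
    have h3 : |besselY n x| ≤ ‖hankelH1ofNat n x‖ := by
      have := Complex.abs_im_le_norm (hankelH1ofNat n x)
      simpa [hankelH1ofNat] using this
    have h4 : K * P ≤ F / (2 * π) := by
      rw [le_div_iff₀ (by positivity)]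
      linarith
    have h5 : F / π = F / (2 * π) + F / (2 * π) := by
      field_simp
      norm_num
    linarith
  rw [hH.deriv]
  calc _ ≤ (1 / x + 1) * (n + 1) * F / (F / (2 * π)) := by gcongr
    _ = 2 * π * (1 / x + 1) * (n + 1) := by field_simp

theorem norm_dtnCoeff {k : ℝ} (hk : 0 < k) (R : ℝ) (n : ℤ) :
    ‖dtnCoeff k R n‖ = k * (‖deriv (hankelH1ofNat n.natAbs) (k * R)‖ /
      ‖hankelH1ofNat n.natAbs (k * R)‖) := by
  have hk' : ‖(k : ℂ)‖ = k := by rw [Complex.norm_real, Real.norm_of_nonneg hk.le]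
  rw [dtnCoeff, hankelH1d, norm_div, norm_mul, hk', mul_div_assoc]
  by_cases hn : 0 ≤ n
  · simp only [hankelH1, if_pos hn]
  · simp only [hankelH1, if_neg hn]
    rw [deriv_const_mul_field]
    simp

theorem exists_norm_dtnCoeff_le {k R : ℝ} (hk : 0 < k) (hR : 0 < R) :
    ∃ c > 0, ∀ n : ℤ, ‖dtnCoeff k R n‖ ^ 2 ≤ c ^ 2 * (1 + (n : ℝ) ^ 2) := by
  obtain ⟨C, hC⟩ := eventually_norm_deriv_hankel_le (mul_pos hk hR)
  obtain ⟨B, hB⟩ := Filter.IsBoundedUnder.bddAbove_range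
    (f := fun n : ℕ => ‖deriv (hankelH1ofNat n) (k * R)‖ / ‖hankelH1ofNat n (k * R)‖ / (n + 1))
    ⟨C, eventually_map.2 <| hC.mono fun n h => (div_le_iff₀ (by positivity)).2 h⟩
  refine ⟨2 * k * (|B| + 1), by positivity, fun n => ?_⟩
  have h := hB ⟨n.natAbs, rfl⟩
  have hcast : ((n.natAbs : ℕ) : ℝ) = |(n : ℝ)| := by simp
  simp only [hcast] at h
  rw [div_le_iff₀ (by positivity)] at h
  have hn : ‖dtnCoeff k R n‖ ≤ k * ((|B| + 1) * (|(n : ℝ)| + 1)) := by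
    rw [norm_dtnCoeff hk]
    gcongr
    refine h.trans ?_
    gcongr
    linarith [le_abs_self B]
  calc ‖dtnCoeff k R n‖ ^ 2 ≤ (k * ((|B| + 1) * (|(n : ℝ)| + 1))) ^ 2 := by gcongr
    _ = (k * (|B| + 1)) ^ 2 * (|(n : ℝ)| + 1) ^ 2 := by ring
    _ ≤ (k * (|B| + 1)) ^ 2 * (4 * (1 + (n : ℝ) ^ 2)) := by
        gcongr
        nlinarith [sq_abs (n : ℝ), sq_nonneg (|(n : ℝ)| - 1)]
    _ = (2 * k * (|B| + 1)) ^ 2 * (1 + (n : ℝ) ^ 2) := by ring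

/-- **Theorem 3.1**: for `s ≥ 1/2` the DtN mapping `S` is a bounded linear
operator from `H^s(Γ_R)` to `H^{s-1}(Γ_R)`.  Functions on `Γ_R` are
represented by their Fourier coefficient sequences. -/
theorem dtn_bounded (k R : ℝ) (hk : 0 < k) (hR : 0 < R) (s : ℝ) (hs : 1 / 2 ≤ s) :
    ∃ c > 0, ∀ a : ℤ → ℂ, MemHseq s a →
      MemHseq (s - 1) (fun n => dtnCoeff k R n * a n) ∧
        hSeqNorm (s - 1) (fun n => dtnCoeff k R n * a n) ≤ c * hSeqNorm s a := by
  obtain ⟨c, hc, hbound⟩ := exists_norm_dtnCoeff_le hk hR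
  refine ⟨c, hc, fun a ha => ?_⟩
  have hterm : ∀ n : ℤ, (1 + (n : ℝ) ^ 2) ^ (s - 1) * ‖dtnCoeff k R n * a n‖ ^ 2
      ≤ c ^ 2 * ((1 + (n : ℝ) ^ 2) ^ s * ‖a n‖ ^ 2) := by
    intro n
    have hpos : 0 < 1 + (n : ℝ) ^ 2 := by positivity
    rw [norm_mul, mul_pow]
    calc (1 + (n : ℝ) ^ 2) ^ (s - 1) * (‖dtnCoeff k R n‖ ^ 2 * ‖a n‖ ^ 2)
        ≤ (1 + (n : ℝ) ^ 2) ^ (s - 1) * (c ^ 2 * (1 + (n : ℝ) ^ 2) * ‖a n‖ ^ 2) := by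
          gcongr
          exact hbound n
      _ = c ^ 2 * ((1 + (n : ℝ) ^ 2) ^ s * ‖a n‖ ^ 2) := by
          rw [Real.rpow_sub_one hpos.ne']
          field_simp
  have hsum : MemHseq (s - 1) (fun n => dtnCoeff k R n * a n) :=
    Summable.of_nonneg_of_le (fun n => by positivity) hterm (ha.mul_left _)
  refine ⟨hsum, ?_⟩
  rw [hSeqNorm, hSeqNorm, ← Real.sqrt_sq hc.le, ← Real.sqrt_mul (sq_nonneg c),
    ← tsum_mul_left]
  exact Real.sqrt_le_sqrt (hsum.tsum_le_tsum hterm (ha.mul_left _))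

end FSI
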